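/- For every integer M ≥ 3 and every real s ≥ 0, Δ(s, M) ≤ Δ_M, where Δ(s, M) = log₂(1+s) − ∫₀¹ log₂(1 + (M s/2) u²) · 2(M−1)(M−2) u³ (1−u²)^{M−3} du and Δ_M = 2(M−1)(M−2) ∫₀¹ log₂( 2/(M u²) ) u³ (1−u²)^{M−3} du. -/

import Mathlib

lemma aux_int_w (n : ℕ) :
    ∫ u in (0:ℝ)..1, (2 * ((n:ℝ) + 2) * ((n:ℝ) + 1) * u ^ 3 * (1 - u ^ 2) ^ n) = 1 := by
  have h : ∀ u ∈ Set.uIcc (0:ℝ) 1, HasDerivAt (fun u : ℝ =>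
      -((n:ℝ) + 2) * (1 - u ^ 2) ^ (n + 1) + ((n:ℝ) + 1) * (1 - u ^ 2) ^ (n + 2))
      (2 * ((n:ℝ) + 2) * ((n:ℝ) + 1) * u ^ 3 * (1 - u ^ 2) ^ n) u := by
    intro u _
    have h0 : HasDerivAt (fun u : ℝ => 1 - u ^ 2) (-(2 * u)) u := by
      simpa using (hasDerivAt_pow 2 u).const_sub 1
    have h1 := ((h0.pow (n + 1)).const_mul (-((n:ℝ) + 2))).add
      ((h0.pow (n + 2)).const_mul ((n:ℝ) + 1))
    refine h1.congr_deriv ?_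
    simp only [Nat.add_sub_cancel, show n + 2 - 1 = n + 1 from rfl]
    push_cast
    ring
  rw [intervalIntegral.integral_eq_sub_of_hasDerivAt h
    (Continuous.intervalIntegrable (by fun_prop) _ _)]
  simp
  norm_num

lemma aux_int_x (n : ℕ) :
    ∫ u in (0:ℝ)..1, ((((n:ℝ) + 3) / 2 * u ^ 2 - 1) *
      (2 * ((n:ℝ) + 2) * ((n:ℝ) + 1) * u ^ 3 * (1 - u ^ 2) ^ n)) = 0 := by
  have h : ∀ u ∈ Set.uIcc (0:ℝ) 1, HasDerivAt (fun u : ℝ =>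
      -(((n:ℝ) + 2) * ((n:ℝ) + 1) / 2) * (u ^ 4 * (1 - u ^ 2) ^ (n + 1)))
      ((((n:ℝ) + 3) / 2 * u ^ 2 - 1) *
      (2 * ((n:ℝ) + 2) * ((n:ℝ) + 1) * u ^ 3 * (1 - u ^ 2) ^ n)) u := by
    intro u _
    have h0 : HasDerivAt (fun u : ℝ => 1 - u ^ 2) (-(2 * u)) u := by
      simpa using (hasDerivAt_pow 2 u).const_sub 1
    have h1 := ((hasDerivAt_pow 4 u).mul (h0.pow (n + 1))).const_mul
      (-(((n:ℝ) + 2) * ((n:ℝ) + 1) / 2))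
    refine h1.congr_deriv ?_
    simp only [Nat.add_sub_cancel, Pi.pow_apply]
    push_cast
    ring
  rw [intervalIntegral.integral_eq_sub_of_hasDerivAt h
    (Continuous.intervalIntegrable (by fun_prop) _ _)]
  simp

lemma aux_pt (s X : ℝ) (hs : 0 ≤ s) (hX : 0 < X) :
    Real.log (1 + s) - Real.log (1 + s * X) - Real.log (1 / X) ≤ (X - 1) / (1 + s) := by
  have h1 : 0 < 1 + s := by linarith
  have h2 : 0 < 1 + s * X := by positivity
  have h3 : Real.log (1 + s) - Real.log (1 + s * X) - Real.log (1 / X)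
      = Real.log ((1 + s) * X / (1 + s * X)) := by
    rw [one_div, Real.log_inv, Real.log_div (by positivity) (by positivity),
      Real.log_mul (by positivity) (by positivity)]
    ring
  rw [h3]
  refine (Real.log_le_sub_one_of_pos (by positivity)).trans ?_
  have h4 : (X - 1) / (1 + s) - ((1 + s) * X / (1 + s * X) - 1)
      = s * (X - 1) ^ 2 / ((1 + s) * (1 + s * X)) := by
    field_simp
    ring
  have h5 : 0 ≤ s * (X - 1) ^ 2 / ((1 + s) * (1 + s * X)) := by positivity
  linarith

/-- For every integer `M ≥ 3` and every real `s ≥ 0`, `Δ(s, M) ≤ Δ_M`, where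
`Δ(s, M) = log₂(1+s) − ∫₀¹ log₂(1 + (M s/2) u²) · 2(M−1)(M−2) u³ (1−u²)^{M−3} du` and
`Δ_M = 2(M−1)(M−2) ∫₀¹ log₂( 2/(M u²) ) u³ (1−u²)^{M−3} du`. -/
theorem gap_le_high_snr_gap (M : ℕ) (hM : 3 ≤ M) (s : ℝ) (hs : 0 ≤ s) :
    Real.logb 2 (1 + s) -
      (∫ u in (0:ℝ)..1, Real.logb 2 (1 + (M * s / 2) * u ^ 2) *
        (2 * ((M:ℝ) - 1) * ((M:ℝ) - 2) * u ^ 3 * (1 - u ^ 2) ^ (M - 3)))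
    ≤ 2 * ((M:ℝ) - 1) * ((M:ℝ) - 2) *
      ∫ u in (0:ℝ)..1, Real.logb 2 (2 / (M * u ^ 2)) * u ^ 3 * (1 - u ^ 2) ^ (M - 3) := by
  obtain ⟨n, rfl⟩ : ∃ n, M = n + 3 := ⟨M - 3, by omega⟩
  have e1 : ((n + 3 : ℕ) : ℝ) - 1 = n + 2 := by push_cast; ring
  have e2 : ((n + 3 : ℕ) : ℝ) - 2 = n + 1 := by push_cast; ring
  have e3 : ((n + 3 : ℕ) : ℝ) = n + 3 := by push_cast; ring
  rw [e1, e2, e3, Nat.add_sub_cancel]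
  have hl : 0 < Real.log 2 := Real.log_pos (by norm_num)
  set w : ℝ → ℝ := fun u => 2 * ((n:ℝ) + 2) * ((n:ℝ) + 1) * u ^ 3 * (1 - u ^ 2) ^ n with hw
  have hwc : Continuous w := by fun_prop
  have i1 : IntervalIntegrable (fun u : ℝ => Real.logb 2 (1 + s) * w u)
      MeasureTheory.volume 0 1 := (continuous_const.mul hwc).intervalIntegrable _ _
  have i2 : IntervalIntegrable (fun u : ℝ => Real.logb 2 (1 + ((n + 3) * s / 2) * u ^ 2) * w u)
      MeasureTheory.volume 0 1 := by
    refine Continuous.intervalIntegrable (Continuous.mul ?_ hwc) _ _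
    unfold Real.logb
    refine Continuous.div_const (Continuous.log (by fun_prop) ?_) _
    intro u
    positivity
  have i3 : IntervalIntegrable (fun u : ℝ => 2 * ((n:ℝ) + 2) * ((n:ℝ) + 1) *
      (Real.logb 2 (2 / ((n + 3) * u ^ 2)) * u ^ 3 * (1 - u ^ 2) ^ n))
      MeasureTheory.volume 0 1 := by
    have : (fun u : ℝ => 2 * ((n:ℝ) + 2) * ((n:ℝ) + 1) *
      (Real.logb 2 (2 / ((n + 3) * u ^ 2)) * u ^ 3 * (1 - u ^ 2) ^ n)) = fun u : ℝ =>
      2 * ((n:ℝ) + 2) * ((n:ℝ) + 1) / Real.log 2 * (Real.log (2 / (n + 3)) * u ^ 3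
        - 2 * u ^ 2 * (u * Real.log u)) * (1 - u ^ 2) ^ n := by
      funext u
      by_cases hu : u = 0
      · simp [hu]
      · have : 2 / (((n:ℝ) + 3) * u ^ 2) = 2 / (n + 3) / u ^ 2 := by rw [div_div]
        rw [this, Real.logb, Real.log_div (by positivity) (by positivity), Real.log_pow]
        push_cast
        ring
    rw [this]
    have := Real.continuous_mul_log
    exact Continuous.intervalIntegrable (by fun_prop) _ _
  have i4 : IntervalIntegrable (fun u : ℝ => 1 / ((1 + s) * Real.log 2) *
      ((((n:ℝ) + 3) / 2 * u ^ 2 - 1) * w u)) MeasureTheory.volume 0 1 :=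
    Continuous.intervalIntegrable (by fun_prop) _ _
  have key := intervalIntegral.integral_mono_on_of_le_Ioo (zero_le_one' ℝ) ((i1.sub i2).sub i3) i4
    (by
      intro u hu
      obtain ⟨hu0, hu1⟩ := hu
      have hX : 0 < ((n:ℝ) + 3) / 2 * u ^ 2 := by positivity
      have hp := aux_pt s _ hs hX
      have hw0 : 0 ≤ w u := by
        have : 0 ≤ 1 - u ^ 2 := by nlinarith
        simp only [hw]; positivity
      have hp2 := mul_le_mul_of_nonneg_right hp (div_nonneg hw0 hl.le)
      have a1 : 1 + s * (((n:ℝ) + 3) / 2 * u ^ 2) = 1 + ((n + 3) * s / 2) * u ^ 2 := by ring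
      have a2 : 1 / (((n:ℝ) + 3) / 2 * u ^ 2) = 2 / ((n + 3) * u ^ 2) := by field_simp
      rw [a1, a2] at hp2
      have hs1 : (1 + s) ≠ 0 := by positivity
      calc _ = _ := ?_
        _ ≤ _ := hp2
        _ = _ := ?_
      · simp only [Real.logb, hw]; ring
      · field_simp)
  rw [intervalIntegral.integral_sub (i1.sub i2) i3, intervalIntegral.integral_sub i1 i2,
    intervalIntegral.integral_const_mul, intervalIntegral.integral_const_mul,
    intervalIntegral.integral_const_mul,
    aux_int_w, aux_int_x] at key
  linarith
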